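/- Let g ∈ Γ be an infinite order element and h ∈ Γ with h·g⁺ ≠ g⁻. Then there exists m_{g,h} ∈ ℕ such that: (1) the element gⁿh is of infinite order for every n ≥ m_{g,h}; and (2) the sequence {(gⁿh)⁺}_{n ≥ m_{g,h}} of attracting fixed points converges to g⁺ in ∂Γ. -/

import Mathlib

open Filter Topology MeasureTheory
open scoped ENNReal

namespace HarmonicBoundary

variable {Γ : Type} [Group Γ]

/-- Word length of `g` with respect to a generating set `S`. -/
noncomputable def wl (S : Set Γ) (g : Γ) : ℕ :=
  sInf {n : ℕ | ∃ w : List Γ, w.length = n ∧ (∀ x ∈ w, x ∈ S) ∧ w.prod = g}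

/-- Word metric `d(x,y) = |x⁻¹y|`. -/
noncomputable def wdist (S : Set Γ) (x y : Γ) : ℕ := wl S (x⁻¹ * y)

/-- Gromov product `(x|y)_z = (d(x,z)+d(y,z)-d(x,y))/2`. -/
noncomputable def gp (S : Set Γ) (z x y : Γ) : ℝ :=
  ((wdist S x z : ℝ) + (wdist S y z : ℝ) - (wdist S x y : ℝ)) / 2

/-- `S` is a finite symmetric generating set of `Γ`. -/
def IsGenSet (S : Set Γ) : Prop :=
  S.Finite ∧ (∀ s ∈ S, s⁻¹ ∈ S) ∧ Subgroup.closure S = ⊤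

/-- `Γ` is `δ`-hyperbolic with respect to the word metric of `S`:
`(x|y) ≥ min ((x|z), (y|z)) - δ` for all `x y z`. -/
def IsHyperbolic (S : Set Γ) (δ : ℝ) : Prop :=
  0 ≤ δ ∧ ∀ x y z : Γ, min (gp S 1 x z) (gp S 1 y z) - δ ≤ gp S 1 x y

/-- `Γ` is nonelementary: it has no cyclic subgroup of finite index. -/
def Nonelementary (Γ : Type) [Group Γ] : Prop :=
  ∀ g : Γ, (Subgroup.zpowers g).index = 0

/-- A sequence converges to infinity if `(x_i|x_j) → ∞`. -/
def ConvInf (S : Set Γ) (u : ℕ → Γ) : Prop :=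
  Tendsto (fun p : ℕ × ℕ => gp S 1 (u p.1) (u p.2)) atTop atTop

/-- Two sequences converging to infinity are equivalent if `(x_i|y_j) → ∞`. -/
def EquivSeq (S : Set Γ) (u v : ℕ → Γ) : Prop :=
  Tendsto (fun p : ℕ × ℕ => gp S 1 (u p.1) (v p.2)) atTop atTop

/-- An (abstract model of the) Gromov boundary of `Γ`: the points are exactly the
classes of sequences converging to infinity, modulo the equivalence `EquivSeq`,
together with the natural left action of `Γ`. -/
structure Boundary (Γ : Type) [Group Γ] (S : Set Γ) where
  pt : Type
  cls : (ℕ → Γ) → pt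
  cls_surj : ∀ ξ : pt, ∃ u : ℕ → Γ, ConvInf S u ∧ cls u = ξ
  cls_eq : ∀ u v : ℕ → Γ, ConvInf S u → ConvInf S v → (cls u = cls v ↔ EquivSeq S u v)
  smul : Γ → pt → pt
  smul_cls : ∀ (g : Γ) (u : ℕ → Γ), ConvInf S u → smul g (cls u) = cls fun n => g * u n

/-- Extension of the Gromov product to the boundary:
`(ξ|η) = sup liminf (x_i|y_j)` over sequences representing `ξ` and `η`,
as an extended nonnegative real. -/
noncomputable def bgp {S : Set Γ} (B : Boundary Γ S) (ξ η : B.pt) : ℝ≥0∞ :=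
  ⨆ (u : {u : ℕ → Γ // ConvInf S u ∧ B.cls u = ξ})
    (v : {v : ℕ → Γ // ConvInf S v ∧ B.cls v = η}),
    Filter.liminf (fun p : ℕ × ℕ => ENNReal.ofReal (gp S 1 (u.1 p.1) (v.1 p.2))) atTop

/-- Real-valued Gromov product on the boundary (finite for `ξ ≠ η`). -/
noncomputable def bgpR {S : Set Γ} (B : Boundary Γ S) (ξ η : B.pt) : ℝ := (bgp B ξ η).toReal

/-- The canonical topology of the Gromov boundary: a set is open iff around each of
its points it contains a basic neighbourhood `V_r(p) = {q | (q|p) > r}`. -/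
def btop {S : Set Γ} (B : Boundary Γ S) : TopologicalSpace B.pt where
  IsOpen O := ∀ p ∈ O, ∃ r : ℝ≥0∞, r ≠ ⊤ ∧ {q | r < bgp B q p} ⊆ O
  isOpen_univ := fun p _ => ⟨0, ENNReal.zero_ne_top, fun q _ => trivial⟩
  isOpen_inter := by
    intro A A' hA hA' p hp
    obtain ⟨r1, hr1, h1⟩ := hA p hp.1
    obtain ⟨r2, hr2, h2⟩ := hA' p hp.2
    refine ⟨max r1 r2, (max_lt hr1.lt_top hr2.lt_top).ne, fun q hq => ?_⟩
    have hq' : max r1 r2 < bgp B q p := hq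
    exact ⟨h1 (show r1 < bgp B q p from (le_max_left r1 r2).trans_lt hq'),
      h2 (show r2 < bgp B q p from (le_max_right r1 r2).trans_lt hq')⟩
  isOpen_sUnion := by
    intro s hs p hp
    obtain ⟨t, ht, hpt⟩ := hp
    obtain ⟨r, hr, hsub⟩ := hs t ht p hpt
    exact ⟨r, hr, fun q hq => ⟨t, ht, hsub hq⟩⟩

/-- The attracting fixed point `g⁺ = lim_n gⁿ` of an (infinite order) element. -/
def plusPt {S : Set Γ} (B : Boundary Γ S) (g : Γ) : B.pt := B.cls fun n => g ^ n

/-- The repelling fixed point `g⁻ = lim_n g⁻ⁿ` of an (infinite order) element. -/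
def minusPt {S : Set Γ} (B : Boundary Γ S) (g : Γ) : B.pt := B.cls fun n => g⁻¹ ^ n

/-- A geodesic ray starting at the identity. -/
def IsGeodesicRay (S : Set Γ) (x : ℕ → Γ) : Prop :=
  x 0 = 1 ∧ ∀ m n : ℕ, wdist S (x m) (x n) = Nat.dist m n

/-- A geodesic ray from `e` to the boundary point `ξ`, i.e. an element of `[e,ξ]`. -/
def RayTo {S : Set Γ} (B : Boundary Γ S) (x : ℕ → Γ) (ξ : B.pt) : Prop :=
  IsGeodesicRay S x ∧ ConvInf S x ∧ B.cls x = ξ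

/-- A geodesic segment from `x` to `y` (parametrized on `0,…,d(x,y)`),
i.e. an element of `[x,y]`. -/
def IsGeodesicSeg (S : Set Γ) (x y : Γ) (α : ℕ → Γ) : Prop :=
  α 0 = x ∧ α (wdist S x y) = y ∧
  ∀ m n : ℕ, m ≤ wdist S x y → n ≤ wdist S x y → wdist S (α m) (α n) = Nat.dist m n

/-- The boundary "cylinder" `U(ξ,R)`: all `η` such that for every pair of geodesic
rays `x ∈ [e,ξ]`, `y ∈ [e,η]` one has `lim_n (x(n)|y(n)) > R` (the sequence
`(x(n)|y(n))` is nondecreasing, so the limit exceeds `R` iff some term does). -/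
def Uset {S : Set Γ} (B : Boundary Γ S) (ξ : B.pt) (R : ℝ) : Set B.pt :=
  {η | ∀ x y : ℕ → Γ, RayTo B x ξ → RayTo B y η → ∃ n : ℕ, R < gp S 1 (x n) (y n)}

/-- `C_r(p) = {g | (g|e)_p > r}`. -/
def Cset (S : Set Γ) (p : Γ) (r : ℝ) : Set Γ := {g | r < gp S p g 1}

/-- The `R`-neighbourhood `N(α,R)` of a geodesic segment `α ∈ [x,y]`. -/
def segN (S : Set Γ) (x y : Γ) (α : ℕ → Γ) (R : ℝ) : Set Γ :=
  {g | ∃ i ≤ wdist S x y, (wdist S g (α i) : ℝ) ≤ R}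

/-- The `R`-neighbourhood `N(A,R)` of a subset `A ⊆ Γ`. -/
def setN (S : Set Γ) (A : Set Γ) (R : ℝ) : Set Γ :=
  {g | ∃ a ∈ A, (wdist S g a : ℝ) ≤ R}

/-- `μ` is a nondegenerate probability measure on `Γ` with support contained in `S`:
nonnegative, of total mass one, supported in `S`, and the semigroup generated by its
support is the whole of `Γ`. -/
structure IsRWMeasure (S : Set Γ) (μ : Γ → ℝ) : Prop where
  nonneg : ∀ g, 0 ≤ μ g
  support_subset : ∀ g, μ g ≠ 0 → g ∈ S
  total : ∑' g : Γ, μ g = 1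
  nondeg : ∀ g : Γ, ∃ l : List Γ, l ≠ [] ∧ (∀ x ∈ l, 0 < μ x) ∧ l.prod = g

open Classical in
/-- `n`-step transition probabilities `p⁽ⁿ⁾(x,y) = μ*ⁿ(x⁻¹y)` of the random walk. -/
noncomputable def ptrans (μ : Γ → ℝ) : ℕ → Γ → Γ → ℝ
  | 0 => fun x y => if x = y then 1 else 0
  | n + 1 => fun x y => ∑' z : Γ, ptrans μ n x z * μ (z⁻¹ * y)

/-- Green function `G(x,y) = Σ_n p⁽ⁿ⁾(x,y)`. -/
noncomputable def green (μ : Γ → ℝ) (x y : Γ) : ℝ := ∑' n : ℕ, ptrans μ n x y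

/-- `F(x,y) = G(x,y)/G(y,y)`, the probability that the walk from `x` ever hits `y`. -/
noncomputable def greenF (μ : Γ → ℝ) (x y : Γ) : ℝ := green μ x y / green μ y y

/-- The Martin kernel `K(x,y) = G(x,y)/G(e,y)`. -/
noncomputable def martinK (μ : Γ → ℝ) (x y : Γ) : ℝ := green μ x y / green μ 1 y

open Classical in
/-- Transition probabilities of the walk restricted to `Δ` (killed when leaving `Δ`). -/
noncomputable def ptransR (μ : Γ → ℝ) (Δ : Set Γ) : ℕ → Γ → Γ → ℝ
  | 0 => fun x y => if x = y ∧ x ∈ Δ then 1 else 0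
  | n + 1 => fun x y => if y ∈ Δ then ∑' z : Γ, ptransR μ Δ n x z * μ (z⁻¹ * y) else 0

/-- Green function `G_Δ` of the restricted walk. -/
noncomputable def greenR (μ : Γ → ℝ) (Δ : Set Γ) (x y : Γ) : ℝ := ∑' n : ℕ, ptransR μ Δ n x y

/-- `F_Δ(x,y) = G_Δ(x,y)/G_Δ(y,y)`. -/
noncomputable def greenFR (μ : Γ → ℝ) (Δ : Set Γ) (x y : Γ) : ℝ :=
  greenR μ Δ x y / greenR μ Δ y y

/-- Generating function `G_Δ(x,y|z) = Σ_n p_Δ⁽ⁿ⁾(x,y) zⁿ`. -/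
noncomputable def greenRZ (μ : Γ → ℝ) (Δ : Set Γ) (x y : Γ) (z : ℝ) : ℝ :=
  ∑' n : ℕ, ptransR μ Δ n x y * z ^ n

/-- Spectral radius `ρ(P) = lim_n p⁽ⁿ⁾(e,e)^{1/n}` of the walk. -/
noncomputable def specRad (μ : Γ → ℝ) : ℝ :=
  Filter.limsup (fun n : ℕ => (ptrans μ n 1 1) ^ ((n : ℝ)⁻¹)) atTop

/-- `u` is harmonic on `Λ`: `Σ_h p(g,h) u(h) = u(g)` for `g ∈ Λ`, `p(g,h)=μ(g⁻¹h)`. -/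
def HarmonicOn (μ : Γ → ℝ) (u : Γ → ℝ) (Λ : Set Γ) : Prop :=
  ∀ g ∈ Λ, (∑' h : Γ, μ (g⁻¹ * h) * u h) = u g

/-- `u` vanishes at infinity on `Λ`: `u(g_n) → 0` along sequences in `Λ` with `|g_n|→∞`. -/
def VanishesAtInftyOn (S : Set Γ) (u : Γ → ℝ) (Λ : Set Γ) : Prop :=
  ∀ ε : ℝ, 0 < ε → ∃ M : ℕ, ∀ g ∈ Λ, M ≤ wl S g → |u g| ≤ ε

open Classical in
/-- `r(g) = K(g⁻¹,g⁺)` for infinite order `g`, and `r(g) = 1` for finite order `g`;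
here `Kb` is the boundary extension of the Martin kernel. -/
noncomputable def rfun {S : Set Γ} (B : Boundary Γ S) (Kb : Γ → B.pt → ℝ) (g : Γ) : ℝ :=
  if IsOfFinOrder g then 1 else Kb g⁻¹ (plusPt B g)

/-- The ratio set `r(Γ,∂Γ,ν)`: all `l ≥ 0` such that for every `ε > 0` and every
Borel `A` of positive measure there is `g ∈ Γ` such that
`{ω ∈ gA ∩ A : |d(gν)/dν(ω) − l| < ε}` has positive measure; here the
Radon–Nikodym derivative `d(gν)/dν` is the Martin kernel `Kb g`. -/
def ratioSet {S : Set Γ} (B : Boundary Γ S) [MeasurableSpace B.pt]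
    (ν : Measure B.pt) (Kb : Γ → B.pt → ℝ) : Set ℝ :=
  {l : ℝ | 0 ≤ l ∧ ∀ ε : ℝ, 0 < ε → ∀ A : Set B.pt, MeasurableSet A → 0 < ν A →
    ∃ g : Γ, 0 < ν {ω | ω ∈ A ∧ B.smul g⁻¹ ω ∈ A ∧ |Kb g ω - l| < ε}}

/-- A left invariant finitely additive mean on `Γ`; `Γ` is amenable iff one exists. -/
structure InvariantMean (Γ : Type) [Group Γ] where
  m : Set Γ → ℝ
  nonneg : ∀ A, 0 ≤ m A
  total : m Set.univ = 1
  fin_add : ∀ A B : Set Γ, Disjoint A B → m (A ∪ B) = m A + m B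
  invariant : ∀ (g : Γ) (A : Set Γ), m ((g * ·) ⁻¹' A) = m A



section Helpers

theorem wl_exists {S : Set Γ} (hS : IsGenSet S) (x : Γ) :
    ∃ w : List Γ, w.length = wl S x ∧ (∀ y ∈ w, y ∈ S) ∧ w.prod = x := by
  have hne : {n : ℕ | ∃ w : List Γ, w.length = n ∧ (∀ y ∈ w, y ∈ S) ∧ w.prod = x}.Nonempty := by
    have hx : x ∈ Subgroup.closure S := by rw [hS.2.2]; trivial
    rw [← Subgroup.mem_toSubmonoid, Subgroup.closure_toSubmonoid] at hx
    obtain ⟨l, hl, hp⟩ := Submonoid.exists_list_of_mem_closure hx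
    refine ⟨l.length, l, rfl, fun y hy => ?_, hp⟩
    rcases hl y hy with h | h
    · exact h
    · simpa using hS.2.1 _ h
  exact Nat.sInf_mem hne

theorem wl_le {S : Set Γ} (w : List Γ) (hw : ∀ y ∈ w, y ∈ S) : wl S w.prod ≤ w.length :=
  Nat.sInf_le ⟨w, rfl, hw, rfl⟩

theorem wl_one {S : Set Γ} : wl S (1 : Γ) = 0 := by
  have := wl_le (S := S) ([] : List Γ) (by simp)
  simpa using this

theorem wl_mul {S : Set Γ} (hS : IsGenSet S) (x y : Γ) : wl S (x * y) ≤ wl S x + wl S y := by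
  obtain ⟨u, hu, hu1, hu2⟩ := wl_exists hS x
  obtain ⟨v, hv, hv1, hv2⟩ := wl_exists hS y
  have := wl_le (S := S) (u ++ v) (by
    intro z hz
    rcases List.mem_append.1 hz with h | h
    · exact hu1 z h
    · exact hv1 z h)
  simpa [hu, hv, hu2, hv2] using this

theorem wl_inv_le {S : Set Γ} (hS : IsGenSet S) (x : Γ) : wl S x⁻¹ ≤ wl S x := by
  obtain ⟨u, hu, hu1, hu2⟩ := wl_exists hS x
  have := wl_le (S := S) (u.map (fun z => z⁻¹)).reverse (by
    intro z hz
    simp only [List.mem_reverse, List.mem_map] at hz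
    obtain ⟨a, ha, rfl⟩ := hz
    exact hS.2.1 a (hu1 a ha))
  rw [← List.prod_inv_reverse, hu2] at this
  simpa [hu] using this

theorem wl_inv {S : Set Γ} (hS : IsGenSet S) (x : Γ) : wl S x⁻¹ = wl S x :=
  le_antisymm (wl_inv_le hS x) (by simpa using wl_inv_le hS x⁻¹)

theorem wl_split {S : Set Γ} (hS : IsGenSet S) (x : Γ) (i : ℕ) (hi : i ≤ wl S x) :
    ∃ m : Γ, wl S m ≤ i ∧ wl S (m⁻¹ * x) ≤ wl S x - i := by
  obtain ⟨u, hu, hu1, hu2⟩ := wl_exists hS x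
  refine ⟨(u.take i).prod, ?_, ?_⟩
  · have := wl_le (S := S) (u.take i) (fun y hy => hu1 y (List.mem_of_mem_take hy))
    refine this.trans ?_
    simp
  · have := wl_le (S := S) (u.drop i) (fun y hy => hu1 y (List.mem_of_mem_drop hy))
    have h2 : (u.take i).prod⁻¹ * x = (u.drop i).prod := by
      rw [← hu2, ← List.prod_take_mul_prod_drop u i]; group
    rw [h2]
    simpa [hu] using this

theorem ball_finite {S : Set Γ} (hS : IsGenSet S) (R : ℕ) : {x : Γ | wl S x ≤ R}.Finite := by
  have : Finite S := hS.1
  have h1 : {l : List S | l.length ≤ R}.Finite := List.finite_length_le S R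
  refine (h1.image (fun l => (l.map Subtype.val).prod)).subset ?_
  intro x hx
  obtain ⟨u, hu, hu1, hu2⟩ := wl_exists hS x
  lift u to List S using hu1
  refine ⟨u, ?_, hu2⟩
  have hx' : wl S x ≤ R := hx
  simp only [List.length_map] at hu
  simpa [hu] using hx'


noncomputable def ln (S : Set Γ) (x : Γ) : ℝ := (wl S x : ℝ)

theorem ln_nonneg {S : Set Γ} (x : Γ) : 0 ≤ ln S x := Nat.cast_nonneg _

theorem ln_one {S : Set Γ} : ln S (1 : Γ) = 0 := by simp [ln, wl_one]

theorem ln_mul {S : Set Γ} (hS : IsGenSet S) (x y : Γ) : ln S (x * y) ≤ ln S x + ln S y := by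
  unfold ln; exact_mod_cast wl_mul hS x y

theorem ln_inv {S : Set Γ} (hS : IsGenSet S) (x : Γ) : ln S x⁻¹ = ln S x := by
  unfold ln; rw [wl_inv hS]

theorem gp_eq {S : Set Γ} (hS : IsGenSet S) (x y : Γ) :
    gp S 1 x y = (ln S x + ln S y - ln S (x⁻¹ * y)) / 2 := by
  simp only [gp, wdist, mul_one, wl_inv hS, ln]

theorem gp_comm {S : Set Γ} (hS : IsGenSet S) (x y : Γ) : gp S 1 x y = gp S 1 y x := by
  rw [gp_eq hS, gp_eq hS, ← ln_inv hS (x⁻¹ * y), mul_inv_rev, inv_inv]; ring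

theorem gp_mul_right {S : Set Γ} (hS : IsGenSet S) (x y r : Γ) :
    gp S 1 x y - ln S r ≤ gp S 1 x (y * r) := by
  rw [gp_eq hS, gp_eq hS]
  have h1 := ln_mul hS (x⁻¹ * y) r
  have h2 := ln_mul hS (y * r) r⁻¹
  rw [mul_inv_cancel_right, ln_inv hS] at h2
  rw [mul_assoc] at h1
  linarith

theorem gp_mul_left {S : Set Γ} (hS : IsGenSet S) (h x y : Γ) :
    gp S 1 x y - ln S h ≤ gp S 1 (h * x) (h * y) := by
  rw [gp_eq hS, gp_eq hS]
  have h1 := ln_mul hS h⁻¹ (h * x)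
  have h2 := ln_mul hS h⁻¹ (h * y)
  rw [inv_mul_cancel_left, ln_inv hS] at h1 h2
  have h3 : (h * x)⁻¹ * (h * y) = x⁻¹ * y := by group
  rw [h3]
  linarith

theorem hyp_gp {S : Set Γ} {δ : ℝ} (hS : IsGenSet S) (hδ : IsHyperbolic S δ) {x y z : Γ} {r : ℝ}
    (h1 : r ≤ gp S 1 x y) (h2 : r ≤ gp S 1 y z) : r - δ ≤ gp S 1 x z := by
  have h := hδ.2 x z y
  rw [gp_comm hS z y] at h
  have : r ≤ min (gp S 1 x y) (gp S 1 y z) := le_min h1 h2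
  linarith

theorem four_pt {S : Set Γ} {δ : ℝ} (hS : IsGenSet S) (hδ : IsHyperbolic S δ) (a b c d : Γ) :
    ln S (a⁻¹ * b) + ln S (c⁻¹ * d) ≤ ln S (a⁻¹ * c) + ln S (b⁻¹ * d) + 2 * δ ∨
    ln S (a⁻¹ * b) + ln S (c⁻¹ * d) ≤ ln S (a⁻¹ * d) + ln S (b⁻¹ * c) + 2 * δ := by
  have h := hδ.2 (d⁻¹ * a) (d⁻¹ * b) (d⁻¹ * c)
  rw [gp_eq hS, gp_eq hS, gp_eq hS] at h
  have e : ∀ x y : Γ, (d⁻¹ * x)⁻¹ * (d⁻¹ * y) = x⁻¹ * y := fun x y => by group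
  have s : ∀ x : Γ, ln S (d⁻¹ * x) = ln S (x⁻¹ * d) := fun x => by
    rw [← ln_inv hS (d⁻¹ * x), mul_inv_rev, inv_inv]
  rw [e, e, e, s, s, s] at h
  rcases min_le_iff.1 (sub_le_iff_le_add.1 h) with h | h
  · left; linarith
  · right; linarith

theorem l2g {S : Set Γ} {δ : ℝ} (hS : IsGenSet S) (hδ : IsHyperbolic S δ) (f : Γ) (a : ℝ)
    (ha : 0 < a) (hf : ln S f + a + 2 * δ ≤ ln S (f ^ 2)) (n : ℕ) :
    ln S (f ^ n) + a ≤ ln S (f ^ (n + 1)) := by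
  have hd := hδ.1
  induction n with
  | zero =>
    have := ln_mul hS f f
    rw [← pow_two] at this
    simp only [pow_zero, zero_add, pow_one, ln_one]
    linarith
  | succ n ih =>
    have h4 := four_pt hS hδ 1 (f ^ 2) f (f ^ (n + 2))
    have e1 : (1 : Γ)⁻¹ * f ^ 2 = f ^ 2 := by group
    have e2 : f⁻¹ * f ^ (n + 2) = f ^ (n + 1) := by rw [pow_succ' f (n+1)]; group
    have e3 : (1 : Γ)⁻¹ * f = f := by group
    have e4 : (f ^ 2)⁻¹ * f ^ (n + 2) = f ^ n := by rw [add_comm n 2, pow_add]; group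
    have e5 : (1 : Γ)⁻¹ * f ^ (n + 2) = f ^ (n + 2) := by simp
    have e6 : ln S ((f ^ 2)⁻¹ * f) = ln S f := by
      rw [← ln_inv hS]; congr 1; rw [pow_two]; group
    rw [e1, e2, e3, e4, e5, e6] at h4
    rcases h4 with h4 | h4
    · linarith
    · show ln S (f ^ (n + 1)) + a ≤ ln S (f ^ (n + 2))
      linarith

theorem l2g_add {S : Set Γ} {δ : ℝ} (hS : IsGenSet S) (hδ : IsHyperbolic S δ) (f : Γ) (a : ℝ)
    (ha : 0 < a) (hf : ln S f + a + 2 * δ ≤ ln S (f ^ 2)) (n j : ℕ) :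
    ln S (f ^ n) + j * a ≤ ln S (f ^ (n + j)) := by
  induction j with
  | zero => simp
  | succ j ih =>
    have := l2g hS hδ f a ha hf (n + j)
    rw [← add_assoc]
    push_cast
    linarith

theorem l2g_gp' {S : Set Γ} {δ : ℝ} (hS : IsGenSet S) (hδ : IsHyperbolic S δ) (f : Γ) (a : ℝ)
    (ha : 0 < a) (hf : ln S f + a + 2 * δ ≤ ln S (f ^ 2)) (j k : ℕ) :
    j * a ≤ gp S 1 (f ^ j) (f ^ (j + k)) := by
  rw [gp_eq hS]
  have e : (f ^ j)⁻¹ * f ^ (j + k) = f ^ k := by rw [pow_add]; group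
  rw [e]
  have h1 := l2g_add hS hδ f a ha hf k j
  have h2 := l2g_add hS hδ f a ha hf 0 j
  simp only [pow_zero, ln_one, zero_add] at h2
  rw [add_comm k j] at h1
  linarith

theorem l2g_gp {S : Set Γ} {δ : ℝ} (hS : IsGenSet S) (hδ : IsHyperbolic S δ) (f : Γ) (a : ℝ)
    (ha : 0 < a) (hf : ln S f + a + 2 * δ ≤ ln S (f ^ 2)) (N j k : ℕ) (hj : N ≤ j) (hk : N ≤ k) :
    N * a ≤ gp S 1 (f ^ j) (f ^ k) := by
  rcases le_total j k with h | h
  · obtain ⟨i, rfl⟩ := Nat.exists_eq_add_of_le h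
    refine le_trans ?_ (l2g_gp' hS hδ f a ha hf j i)
    gcongr
  · obtain ⟨i, rfl⟩ := Nat.exists_eq_add_of_le h
    rw [gp_comm hS]
    refine le_trans ?_ (l2g_gp' hS hδ f a ha hf k i)
    gcongr

theorem convInf_iff {S : Set Γ} (u v : ℕ → Γ) :
    EquivSeq S u v ↔ ∀ r : ℝ, ∃ N : ℕ, ∀ i j, N ≤ i → N ≤ j → r ≤ gp S 1 (u i) (v j) := by
  unfold EquivSeq
  rw [tendsto_atTop_atTop]
  constructor
  · intro h r
    obtain ⟨⟨a, b⟩, hab⟩ := h r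
    exact ⟨max a b, fun i j hi hj => hab (i, j)
      ⟨(le_max_left _ _).trans hi, (le_max_right _ _).trans hj⟩⟩
  · intro h r
    obtain ⟨N, hN⟩ := h r
    exact ⟨(N, N), fun p hp => hN p.1 p.2 hp.1 hp.2⟩

theorem convInf_iff' {S : Set Γ} (u : ℕ → Γ) :
    ConvInf S u ↔ ∀ r : ℝ, ∃ N : ℕ, ∀ i j, N ≤ i → N ≤ j → r ≤ gp S 1 (u i) (u j) :=
  convInf_iff u u

theorem l2g_conv {S : Set Γ} {δ : ℝ} (hS : IsGenSet S) (hδ : IsHyperbolic S δ) (f : Γ) (a : ℝ)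
    (ha : 0 < a) (hf : ln S f + a + 2 * δ ≤ ln S (f ^ 2)) : ConvInf S (fun n => f ^ n) := by
  rw [convInf_iff']
  intro r
  obtain ⟨N, hN⟩ := exists_nat_ge (r / a)
  rw [div_le_iff₀ ha] at hN
  exact ⟨N, fun i j hi hj => hN.trans (l2g_gp hS hδ f a ha hf N i j hi hj)⟩

theorem l2g_inf {S : Set Γ} {δ : ℝ} (hS : IsGenSet S) (hδ : IsHyperbolic S δ) (f : Γ) (a : ℝ)
    (ha : 0 < a) (hf : ln S f + a + 2 * δ ≤ ln S (f ^ 2)) : ¬ IsOfFinOrder f := by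
  rw [isOfFinOrder_iff_pow_eq_one]
  rintro ⟨n, hn, h⟩
  have h1 := l2g_add hS hδ f a ha hf 0 n
  simp only [zero_add, h, pow_zero, ln_one] at h1
  have : (0 : ℝ) < n := by exact_mod_cast hn
  have := mul_pos this ha
  linarith


theorem mid_dist {S : Set Γ} {δ : ℝ} (hS : IsGenSet S) (hδ : IsHyperbolic S δ)
    (x y m z : Γ) (c e : ℝ) (hx : ln S (x⁻¹ * m) ≤ ln S (x⁻¹ * y) / 2 + 1)
    (hy : ln S (y⁻¹ * m) ≤ ln S (x⁻¹ * y) / 2 + 1)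
    (h1 : ln S (x⁻¹ * z) ≤ c + e) (h2 : ln S (y⁻¹ * z) ≤ c + e) (hc : c = ln S (x⁻¹ * y) / 2) :
    ln S (m⁻¹ * z) ≤ e + 1 + 2 * δ := by
  have sw : ∀ p q : Γ, ln S (p⁻¹ * q) = ln S (q⁻¹ * p) := fun p q => by
    rw [← ln_inv hS (p⁻¹ * q), mul_inv_rev, inv_inv]
  rcases four_pt hS hδ x y m z with h | h
  · linarith
  · linarith

theorem exists_lox {S : Set Γ} {δ : ℝ} (hS : IsGenSet S) (hδ : IsHyperbolic S δ) (g : Γ)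
    (hg : ¬ IsOfFinOrder g) (D : ℝ) (hD : 0 ≤ D) :
    ∃ k : ℕ, 0 < k ∧ ln S (g ^ k) + D < ln S (g ^ (2 * k)) := by
  by_contra! hcon
  have hcon' : ∀ k : ℕ, ln S (g ^ (2 * k)) ≤ ln S (g ^ k) + D := by
    intro k
    rcases Nat.eq_zero_or_pos k with rfl | hk
    · simp [ln_one, hD]
    · exact hcon k hk
  set C : ℝ := D + ln S g with hC
  have hC0 : 0 ≤ C := add_nonneg hD (ln_nonneg g)
  obtain ⟨R, hR⟩ := exists_nat_ge (C + 2 * δ + 1 + C + 1 + 2 * δ + 1)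
  have hfin := ball_finite (S := S) hS R
  set N := hfin.toFinset.card with hN
  obtain ⟨k0, hk0, hmax⟩ := Finset.exists_max_image (Finset.range (N + 1))
    (fun k => ln S (g ^ k)) ⟨0, by simp⟩
  have hk0' : k0 ≤ N := by simpa [Nat.lt_succ_iff] using hk0
  have hmax' : ∀ j ≤ N, ln S (g ^ j) ≤ ln S (g ^ k0) := fun j hj =>
    hmax j (by simpa [Nat.lt_succ_iff] using hj)
  have hmax2 : ∀ j ≤ 2 * N, ln S (g ^ j) ≤ ln S (g ^ k0) + C := by
    intro j hj
    have h1 := hcon' (j / 2)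
    have h2 := hmax' (j / 2) (by omega)
    rcases Nat.even_or_odd' j with ⟨i, rfl | rfl⟩
    · have : 2 * i / 2 = i := by omega
      rw [this] at h1 h2
      have := ln_nonneg (S := S) g
      linarith
    · have : (2 * i + 1) / 2 = i := by omega
      rw [this] at h1 h2
      have := ln_mul hS (g ^ (2 * i)) g
      rw [← pow_succ] at this
      linarith
  set p := g ^ k0 with hp
  obtain ⟨m, hm1, hm2⟩ := wl_split hS p (wl S p / 2) (Nat.div_le_self _ _)
  have hm1' : ln S m ≤ ln S p / 2 := by
    have : (2 : ℝ) * (wl S m : ℝ) ≤ wl S p := by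
      have : 2 * wl S m ≤ wl S p := by omega
      exact_mod_cast this
    unfold ln; linarith
  have hm2' : ln S (p⁻¹ * m) ≤ ln S p / 2 + 1 := by
    have e : p⁻¹ * m = (m⁻¹ * p)⁻¹ := by group
    rw [e, ln_inv hS]
    have : (2 : ℝ) * (wl S (m⁻¹ * p) : ℝ) ≤ wl S p + 2 := by
      have : 2 * wl S (m⁻¹ * p) ≤ wl S p + 2 := by omega
      exact_mod_cast this
    unfold ln; linarith
  have sw : ∀ p q : Γ, ln S (p⁻¹ * q) = ln S (q⁻¹ * p) := fun p q => by
    rw [← ln_inv hS (p⁻¹ * q), mul_inv_rev, inv_inv]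
  have hz : ∀ z : Γ, ln S z ≤ ln S p + C → ln S (p⁻¹ * z) ≤ ln S p + C →
      ln S (m⁻¹ * z) ≤ ln S p / 2 + (C + 2 * δ + 1) := by
    intro z h1 h2
    have := mid_dist hS hδ 1 p m z (ln S p / 2) (ln S p / 2 + C) (by simp; linarith)
      (by simpa using hm2') (by simp; linarith) (by linarith) (by simp)
    linarith
  have hmove : ∀ k ≤ N, wl S (m⁻¹ * (g ^ k * m)) ≤ R := by
    intro k hk
    have h1 : ln S (m⁻¹ * g ^ k) ≤ ln S p / 2 + (C + 2 * δ + 1) := by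
      refine hz _ (hmax2 k (by omega)) ?_
      rcases le_total k k0 with h | h
      · have : p⁻¹ * g ^ k = (g ^ (k0 - k))⁻¹ := by
          rw [hp]; conv_lhs => rw [← Nat.sub_add_cancel h, pow_add]
          group
        rw [this, ln_inv hS]
        exact hmax2 _ (by omega)
      · have : p⁻¹ * g ^ k = g ^ (k - k0) := by
          rw [hp]; conv_lhs => rw [← Nat.add_sub_cancel' h, pow_add]
          group
        rw [this]
        exact hmax2 _ (by omega)
    have h2 : ln S (m⁻¹ * g ^ (k + k0)) ≤ ln S p / 2 + (C + 2 * δ + 1) := by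
      refine hz _ (hmax2 _ (by omega)) ?_
      have : p⁻¹ * g ^ (k + k0) = g ^ k := by
        rw [hp, add_comm, pow_add]; group
      rw [this]
      exact hmax2 _ (by omega)
    have e1 : (g ^ k)⁻¹ * g ^ (k + k0) = p := by rw [hp, pow_add]; group
    have e2 : (g ^ k)⁻¹ * (g ^ k * m) = m := by group
    have e3 : (g ^ (k + k0))⁻¹ * (g ^ k * m) = p⁻¹ * m := by rw [hp, pow_add]; group
    have h3 := mid_dist hS hδ (g ^ k) (g ^ (k + k0)) (g ^ k * m) m (ln S p / 2)
      (C + 2 * δ + 1) (by rw [e1, e2]; linarith) (by rw [e1, e3]; linarith)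
      (by rw [sw]; exact h1) (by rw [sw]; exact h2) (by rw [e1])
    rw [sw] at h3
    have h4 : ln S (m⁻¹ * (g ^ k * m)) ≤ R := by linarith
    unfold ln at h4
    exact_mod_cast h4
  have hinj : Function.Injective (fun k : ℕ => m⁻¹ * (g ^ k * m)) := by
    intro a b hab
    have : g ^ a = g ^ b := by simpa using hab
    exact (injective_pow_iff_not_isOfFinOrder.2 hg) this
  have hcard : (Finset.range (N + 1)).card ≤ hfin.toFinset.card := by
    refine Finset.card_le_card_of_injOn (fun k : ℕ => m⁻¹ * (g ^ k * m)) ?_ hinj.injOn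
    intro k hk
    have hk' : k ≤ N := by simpa [Nat.lt_succ_iff] using hk
    simpa using hmove k hk'
  rw [Finset.card_range] at hcard
  omega

theorem conv_pow {S : Set Γ} {δ : ℝ} (hS : IsGenSet S) (hδ : IsHyperbolic S δ) (g : Γ)
    (hg : ¬ IsOfFinOrder g) : ConvInf S (fun n => g ^ n) := by
  have hd := hδ.1
  obtain ⟨k, hk, hlox⟩ := exists_lox hS hδ g hg (1 + 2 * δ) (by linarith)
  have hf := l2g_conv hS hδ (g ^ k) 1 one_pos (by rw [← pow_mul, mul_comm k 2]; linarith)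
  rw [convInf_iff'] at hf ⊢
  intro r
  obtain ⟨c, hc⟩ : ∃ c : ℝ, ∀ i < k, ln S (g ^ i) ≤ c := by
    obtain ⟨c, hc⟩ := ((Finset.range k).image (fun i => ln S (g ^ i))).bddAbove
    exact ⟨c, fun i hi => hc (by simpa using ⟨i, hi, rfl⟩)⟩
  obtain ⟨N, hN⟩ := hf (r + 2 * c)
  refine ⟨k * N, fun i j hi hj => ?_⟩
  have h1 := hN (i / k) (j / k) ((Nat.le_div_iff_mul_le hk).2 (by linarith))
    ((Nat.le_div_iff_mul_le hk).2 (by linarith))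
  have e : ∀ i : ℕ, g ^ i = (g ^ k) ^ (i / k) * g ^ (i % k) := fun i => by
    rw [← pow_mul, ← pow_add, Nat.div_add_mod]
  have h2 := gp_mul_right hS ((g ^ k) ^ (i / k)) ((g ^ k) ^ (j / k)) (g ^ (j % k))
  rw [← e, gp_comm hS _ (g ^ j)] at h2
  have h3 := gp_mul_right hS (g ^ j) ((g ^ k) ^ (i / k)) (g ^ (i % k))
  rw [← e, gp_comm hS _ (g ^ i)] at h3
  have h4 := hc _ (Nat.mod_lt i hk)
  have h5 := hc _ (Nat.mod_lt j hk)
  linarith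

theorem bounded_of_not_equiv {S : Set Γ} {δ : ℝ} (hS : IsGenSet S) (hδ : IsHyperbolic S δ)
    (u v : ℕ → Γ) (hu : ConvInf S u) (hv : ConvInf S v) (h : ¬ EquivSeq S u v) :
    ∃ (K : ℝ) (N : ℕ), ∀ n, N ≤ n → gp S 1 (u n) (v n) ≤ K := by
  have hd := hδ.1
  rw [convInf_iff] at h
  push Not at h
  obtain ⟨r, hr⟩ := h
  rw [convInf_iff'] at hu hv
  obtain ⟨N1, h1⟩ := hu (r + 2 * δ)
  obtain ⟨N2, h2⟩ := hv (r + 2 * δ)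
  refine ⟨r + 2 * δ, max N1 N2, fun n hn => ?_⟩
  by_contra! hlt
  obtain ⟨i, j, hi, hj, hij⟩ := hr (max N1 N2)
  have a1 := h1 i n ((le_max_left _ _).trans hi) ((le_max_left _ _).trans hn)
  have a2 := h2 n j ((le_max_right _ _).trans hn) ((le_max_right _ _).trans hj)
  have b1 := hyp_gp hS hδ a1 hlt.le
  have b2 := hyp_gp hS hδ b1 (by linarith)
  linarith

theorem le_bgp {S : Set Γ} (B : Boundary Γ S) (u v : ℕ → Γ) (hu : ConvInf S u)
    (hv : ConvInf S v) (r : ℝ) (N : ℕ) (h : ∀ i j, N ≤ i → N ≤ j → r ≤ gp S 1 (u i) (v j)) :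
    ENNReal.ofReal r ≤ bgp B (B.cls u) (B.cls v) := by
  unfold bgp
  refine le_iSup_of_le ⟨u, hu, rfl⟩ (le_iSup_of_le ⟨v, hv, rfl⟩ ?_)
  refine Filter.le_liminf_of_le (by isBoundedDefault) ?_
  filter_upwards [eventually_ge_atTop ((N, N) : ℕ × ℕ)] with p hp
  exact ENNReal.ofReal_le_ofReal (h p.1 p.2 hp.1 hp.2)

theorem tendsto_btop {S : Set Γ} (B : Boundary Γ S) (q : ℕ → B.pt) (p : B.pt)
    (h : ∀ r : ℝ, ∃ N, ∀ n, N ≤ n → ENNReal.ofReal r ≤ bgp B (q n) p) :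
    Tendsto q atTop (@nhds B.pt (btop B) p) := by
  letI := btop B
  rw [tendsto_nhds]
  intro O hO hp
  obtain ⟨r, hr, hsub⟩ := (show ∀ p ∈ O, ∃ r : ℝ≥0∞, r ≠ ⊤ ∧ {q | r < bgp B q p} ⊆ O from hO) p hp
  obtain ⟨N, hN⟩ := h (r.toReal + 1)
  filter_upwards [eventually_ge_atTop N] with n hn
  apply hsub
  refine lt_of_lt_of_le ?_ (hN n hn)
  rw [ENNReal.lt_ofReal_iff_toReal_lt hr]
  linarith

end Helpers

theorem attracting_points_converge
    (Γ : Type) [Group Γ] (S : Set Γ) (δ : ℝ)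
    (hS : IsGenSet S) (hδ : IsHyperbolic S δ) (hne : Nonelementary Γ)
    (B : Boundary Γ S)
    (g : Γ) (hg : ¬ IsOfFinOrder g) (h : Γ)
    (hh : B.smul h (plusPt B g) ≠ minusPt B g) :
    ∃ m0 : ℕ, (∀ n : ℕ, m0 ≤ n → ¬ IsOfFinOrder (g ^ n * h)) ∧
      Tendsto (fun n : ℕ => plusPt B (g ^ n * h)) atTop (@nhds B.pt (btop B) (plusPt B g)) := by
  have hd := hδ.1
  have hc1 := conv_pow hS hδ g hg
  have hc2 := conv_pow hS hδ g⁻¹ (by simpa using hg)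
  have hc3 : ConvInf S (fun n => h * g ^ n) := by
    rw [convInf_iff'] at hc1 ⊢
    intro r
    obtain ⟨N, hN⟩ := hc1 (r + ln S h)
    refine ⟨N, fun i j hi hj => ?_⟩
    have h1 := hN i j hi hj
    have h2 := gp_mul_left hS h (g ^ i) (g ^ j)
    linarith
  have hne' : ¬ EquivSeq S (fun n => h * g ^ n) (fun n => g⁻¹ ^ n) := by
    intro he
    apply hh
    unfold plusPt minusPt
    rw [B.smul_cls h _ hc1]
    exact (B.cls_eq _ _ hc3 hc2).2 he
  obtain ⟨K, N0, hK⟩ := bounded_of_not_equiv hS hδ _ _ hc3 hc2 hne'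
  have hc1' := hc1
  rw [convInf_iff'] at hc1'
  have hlen : ∀ r : ℝ, ∃ N, ∀ n, N ≤ n → r ≤ ln S (g ^ n) := by
    intro r
    obtain ⟨N, hN⟩ := hc1' r
    refine ⟨N, fun n hn => ?_⟩
    have := hN n n hn hn
    rw [gp_eq hS] at this
    simp only [inv_mul_cancel, ln_one] at this
    linarith
  have key : ∀ a : ℝ, ∃ N, ∀ n, N ≤ n →
      ln S (g ^ n * h) + a + 2 * δ ≤ ln S ((g ^ n * h) ^ 2) := by
    intro a
    obtain ⟨N, hN⟩ := hlen (a + 2 * δ + 3 * ln S h + 2 * K)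
    refine ⟨max N N0, fun n hn => ?_⟩
    have h1 := hN n ((le_max_left _ _).trans hn)
    have h2 := hK n ((le_max_right _ _).trans hn)
    rw [gp_eq hS, inv_pow, ln_inv hS] at h2
    have e1 : ln S ((h * g ^ n)⁻¹ * (g ^ n)⁻¹) = ln S (g ^ n * h * g ^ n) := by
      rw [← ln_inv hS]; congr 1; group
    rw [e1] at h2
    have h3 := ln_mul hS h⁻¹ (h * g ^ n)
    rw [inv_mul_cancel_left, ln_inv hS] at h3
    have h4 := ln_mul hS ((g ^ n * h) ^ 2) h⁻¹
    rw [ln_inv hS] at h4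
    have e2 : (g ^ n * h) ^ 2 * h⁻¹ = g ^ n * h * g ^ n := by rw [pow_two]; group
    rw [e2] at h4
    have h5 := ln_mul hS (g ^ n) h
    linarith
  obtain ⟨m0, hm0⟩ := key 1
  refine ⟨m0, fun n hn => l2g_inf hS hδ _ 1 one_pos (hm0 n hn), ?_⟩
  apply tendsto_btop
  intro r
  set a : ℝ := max 1 (r + δ) with ha
  have ha1 : 1 ≤ a := le_max_left _ _
  have ha2 : r + δ ≤ a := le_max_right _ _
  obtain ⟨N1, hN1⟩ := key a
  obtain ⟨N2, hN2⟩ := hc1' (r + δ + ln S h)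
  refine ⟨max N1 N2, fun n hn => ?_⟩
  have hf := hN1 n ((le_max_left _ _).trans hn)
  have hn2 : N2 ≤ n := (le_max_right _ _).trans hn
  have ha0 : 0 < a := by linarith
  refine le_bgp B _ _ (l2g_conv hS hδ _ a ha0 hf) hc1 r (max 1 N2) fun i j hi hj => ?_
  have g1 := l2g_gp hS hδ _ a ha0 hf 1 i 1 ((le_max_left _ _).trans hi) le_rfl
  rw [pow_one] at g1
  have g2 := hN2 j n ((le_max_right _ _).trans hj) hn2
  have g3 := gp_mul_right hS (g ^ j) (g ^ n) h
  rw [gp_comm hS _ (g ^ n * h)] at g3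
  have := hyp_gp hS hδ (r := r + δ) (x := (g ^ n * h) ^ i) (y := g ^ n * h) (z := g ^ j)
    (by push_cast at g1; linarith) (by linarith)
  linarith

end HarmonicBoundary
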